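/- If F is a rooted n-generated descriptive frame for K4.3 (n<ω), then: (a) the strict linear order <_R of clusters of F is converse well-founded, i.e., there is no infinite sequence of clusters with C_n <_R C_{n+1} for all n<ω (equivalently, the set of clusters ordered by the converse of <_R is a well-order, isomorphic to an ordinal); and (b) every cluster of F has at most 2^n points. -/

import Mathlib

/-! ## Modal formulas -/

inductive MF : Type
  | var : ℕ → MF
  | top : MF
  | bot : MF
  | neg : MF → MF
  | and : MF → MF → MF
  | dia : MF → MF
deriving DecidableEq

namespace MF

def or (φ ψ : MF) : MF := .neg (.and (.neg φ) (.neg ψ))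
def imp (φ ψ : MF) : MF := MF.or (.neg φ) ψ
def box (φ : MF) : MF := .neg (.dia (.neg φ))
def diaPlus (φ : MF) : MF := MF.or φ (.dia φ)
def boxPlus (φ : MF) : MF := .and φ (box φ)

/-- the propositional variables occurring in a formula -/
def vars : MF → Finset ℕ
  | .var p => {p}
  | .top => ∅
  | .bot => ∅
  | .neg φ => vars φ
  | .and φ ψ => vars φ ∪ vars ψ
  | .dia φ => vars φ

/-- the signature of a formula -/
def sig (φ : MF) : Set ℕ := ↑(vars φ)

/-- subformulas -/
def subs : MF → Finset MF
  | .var p => {.var p}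
  | .top => {.top}
  | .bot => {.bot}
  | .neg φ => insert (.neg φ) (subs φ)
  | .and φ ψ => insert (.and φ ψ) (subs φ ∪ subs ψ)
  | .dia φ => insert (.dia φ) (subs φ)

/-- `|φ|`: the number of subformulas of `φ` together with their negations -/
def size (φ : MF) : ℕ := ((subs φ) ∪ (subs φ).image MF.neg).card

/-- uniform substitution -/
def substVar (s : ℕ → MF) : MF → MF
  | .var p => s p
  | .top => .top
  | .bot => .bot
  | .neg φ => .neg (substVar s φ)
  | .and φ ψ => .and (substVar s φ) (substVar s ψ)
  | .dia φ => .dia (substVar s φ)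

end MF

/-- a Boolean evaluation of modal formulas (treating `◇`-formulas and variables as atoms) -/
def BoolEval (f : MF → Prop) : Prop :=
  f .top ∧ ¬ f .bot ∧ (∀ φ, f (.neg φ) ↔ ¬ f φ) ∧ (∀ φ ψ, f (.and φ ψ) ↔ (f φ ∧ f ψ))

/-- Boolean tautologies in the modal language -/
def MF.Tautology (φ : MF) : Prop := ∀ f : MF → Prop, BoolEval f → f φ

/-- normal modal logics -/
structure IsNormalLogic (L : Set MF) : Prop where
  taut : ∀ φ, φ.Tautology → φ ∈ L
  axK : MF.imp (MF.box (MF.imp (.var 0) (.var 1)))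
          (MF.imp (MF.box (.var 0)) (MF.box (.var 1))) ∈ L
  mp : ∀ φ ψ, φ ∈ L → MF.imp φ ψ ∈ L → ψ ∈ L
  subst : ∀ φ s, φ ∈ L → MF.substVar s φ ∈ L
  nec : ∀ φ, φ ∈ L → MF.box φ ∈ L

/-- the smallest normal modal logic containing `Γ` -/
def NormClosure (Γ : Set MF) : Set MF :=
  {φ | ∀ L : Set MF, IsNormalLogic L → Γ ⊆ L → φ ∈ L}

def ax4 : MF := MF.imp (MF.box (.var 0)) (MF.box (MF.box (.var 0)))
def ax43 : MF := MF.or (MF.box (MF.imp (MF.boxPlus (.var 0)) (.var 1)))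
                       (MF.box (MF.imp (MF.boxPlus (.var 1)) (.var 0)))
def axGL : MF := MF.imp (MF.box (MF.imp (MF.box (.var 0)) (.var 0))) (MF.box (.var 0))

def K4 : Set MF := NormClosure {ax4}
def K43 : Set MF := NormClosure {ax4, ax43}
def GL3 : Set MF := NormClosure {ax4, ax43, axGL}

/-! ## General frames and models -/

/-- a (general) frame: a relation together with a collection of "internal" sets -/
structure KFrame (W : Type) where
  R : W → W → Prop
  P : Set (Set W)

namespace KFrame

variable {W : Type}

def dia (F : KFrame W) (X : Set W) : Set W := {x | ∃ y ∈ X, F.R x y}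

/-- the conditions making `F` a general frame -/
def IsGeneral (F : KFrame W) : Prop :=
  Nonempty W ∧ ∅ ∈ F.P ∧ Set.univ ∈ F.P ∧
    (∀ X ∈ F.P, ∀ Y ∈ F.P, X ∩ Y ∈ F.P) ∧
    (∀ X ∈ F.P, Xᶜ ∈ F.P) ∧ (∀ X ∈ F.P, F.dia X ∈ F.P)

/-- differentiated, tight and compact -/
def Descriptive (F : KFrame W) : Prop :=
  (∀ x y : W, (∀ X ∈ F.P, x ∈ X ↔ y ∈ X) → x = y) ∧
  (∀ x y : W, F.R x y ↔ ∀ X ∈ F.P, y ∈ X → x ∈ F.dia X) ∧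
  (∀ 𝒳 : Set (Set W), 𝒳 ⊆ F.P →
    (∀ 𝒴 : Set (Set W), 𝒴 ⊆ 𝒳 → 𝒴.Finite → (⋂₀ 𝒴).Nonempty) → (⋂₀ 𝒳).Nonempty)

/-- `x` is a root of `F` (every point is reachable from `x` via the reflexive closure) -/
def Rooted (F : KFrame W) (x : W) : Prop := ∀ y : W, x = y ∨ F.R x y

/-- the strict order on clusters: `C(x) <_R C(y)` -/
def clLT (F : KFrame W) (x y : W) : Prop := F.R x y ∧ ¬ F.R y x

/-- the cluster of a point -/
def cluster (F : KFrame W) (x : W) : Set W := insert x {y | F.R x y ∧ F.R y x}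

def clLE (F : KFrame W) (x y : W) : Prop := y ∈ F.cluster x ∨ F.clLT x y

/-- the closed interval of clusters `[C(x), C(y)]` -/
def interval (F : KFrame W) (x y : W) : Set W := {z | F.clLE x z ∧ F.clLE z y}

/-- `C(x)` is the final cluster -/
def FinalCl (F : KFrame W) (x : W) : Prop := ∀ y, ¬ F.clLT x y

/-- `C(y)` is an immediate successor of `C(x)` -/
def ImmSucc (F : KFrame W) (x y : W) : Prop :=
  F.clLT x y ∧ ¬ ∃ z, F.clLT x z ∧ F.clLT z y

/-- `C(x)` is a limit cluster -/
def LimitCl (F : KFrame W) (x : W) : Prop := ¬ F.FinalCl x ∧ ¬ ∃ y, F.ImmSucc x y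

/-- `C(x)` is a degenerate cluster -/
def DegenerateCl (F : KFrame W) (x : W) : Prop := ¬ F.R x x

end KFrame

/-- the closure of a family of sets under `∩`, complement and `◇` -/
inductive genBy {W : Type} (R : W → W → Prop) (G : Set (Set W)) : Set W → Prop
  | basic {X : Set W} : X ∈ G → genBy R G X
  | empty : genBy R G ∅
  | univ : genBy R G Set.univ
  | inter {X Y : Set W} : genBy R G X → genBy R G Y → genBy R G (X ∩ Y)
  | compl {X : Set W} : genBy R G X → genBy R G Xᶜ
  | dia {X : Set W} : genBy R G X → genBy R G {x | ∃ y ∈ X, R x y}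

def KFrame.GeneratedBy {W : Type} (F : KFrame W) (G : Set (Set W)) : Prop :=
  F.P = {X | genBy F.R G X}

def KFrame.FinGenerated {W : Type} (F : KFrame W) : Prop :=
  ∃ G : Set (Set W), G.Finite ∧ F.GeneratedBy G

def KFrame.NGenerated {W : Type} (F : KFrame W) (n : ℕ) : Prop :=
  ∃ G : Set (Set W), G.Finite ∧ G.ncard = n ∧ F.GeneratedBy G

/-- a model: a frame with a valuation -/
structure KModel (W : Type) where
  F : KFrame W
  v : ℕ → Set W

namespace KModel

variable {W : Type}

/-- the frame is a general frame and all values of the valuation are internal -/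
def IsModel (M : KModel W) : Prop := M.F.IsGeneral ∧ ∀ p, M.v p ∈ M.F.P

/-- truth at a point -/
def sat (M : KModel W) : W → MF → Prop
  | x, .var p => x ∈ M.v p
  | _, .top => True
  | _, .bot => False
  | x, .neg φ => ¬ sat M x φ
  | x, .and φ ψ => sat M x φ ∧ sat M x ψ
  | x, .dia φ => ∃ y, M.F.R x y ∧ sat M y φ

/-- a set is definable in `M` -/
def Definable (M : KModel W) (X : Set W) : Prop := ∃ φ : MF, X = {x | M.sat x φ}

/-- every internal set is definable in `M` -/
def MGenerated (M : KModel W) : Prop := ∀ X ∈ M.F.P, M.Definable X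

/-- finitely `M`-generated -/
def FinMGenerated (M : KModel W) : Prop := M.MGenerated ∧ M.F.FinGenerated

/-- the σ-type of a point: all σ-formulas true at it -/
def stype (M : KModel W) (σ : Set ℕ) (x : W) : Set MF := {φ | φ.sig ⊆ σ ∧ M.sat x φ}

/-- `x` is `Γ`-maximal in `M` -/
def MaxFor (M : KModel W) (Γ : Set MF) (x : W) : Prop :=
  (∀ γ ∈ Γ, M.sat x γ) ∧ ∀ y, M.F.R x y → (∀ γ ∈ Γ, M.sat y γ) → M.F.R y x

/-- the cluster `C(x)` is `μ`-maximal in `M` -/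
def ClMuMax (M : KModel W) (μ : MF) (x : W) : Prop := ∃ z ∈ M.F.cluster x, M.MaxFor {μ} z

/-- the cluster `C(x)` is maximal in `M` -/
def ClMax (M : KModel W) (x : W) : Prop := ∃ μ : MF, M.ClMuMax μ x

/-- the cluster `C(x)` is σ-maximal in `M` -/
def ClSigMax (M : KModel W) (σ : Set ℕ) (x : W) : Prop :=
  ∃ μ : MF, μ.sig ⊆ σ ∧ M.ClMuMax μ x

/-- the cluster `C(x)` is definable in `M` -/
def ClDefinable (M : KModel W) (x : W) : Prop := M.Definable (M.F.cluster x)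

/-- `◇ t^σ_M(x) ⊆ t^σ_M(y)` -/
def diaSubset (M : KModel W) (σ : Set ℕ) (x y : W) : Prop :=
  ∀ φ ∈ M.stype σ x, MF.dia φ ∈ M.stype σ y

/-- the σ-block of a point -/
def sblockOf (M : KModel W) (σ : Set ℕ) (x : W) : Set W :=
  {y | (M.diaSubset σ x x ∧ M.diaSubset σ y x ∧ M.diaSubset σ x y) ∨
       (¬ M.diaSubset σ x x ∧ y = x)}

/-- a σ-block in `M` -/
def IsSBlock (M : KModel W) (σ : Set ℕ) (b : Set W) : Prop := ∃ x, b = M.sblockOf σ x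

/-- a degenerate σ-block in `M` -/
def DegenSBlock (M : KModel W) (σ : Set ℕ) (b : Set W) : Prop :=
  ∃ x, b = M.sblockOf σ x ∧ ¬ M.diaSubset σ x x

end KModel

/-- validity of a formula on a frame -/
def KFrame.Valid {W : Type} (F : KFrame W) (φ : MF) : Prop :=
  ∀ v : ℕ → Set W, (∀ p, v p ∈ F.P) → ∀ x, (KModel.mk F v).sat x φ

/-- `F` is a frame for the logic `L` -/
def KFrame.IsFrameFor {W : Type} (F : KFrame W) (L : Set MF) : Prop :=
  ∀ φ ∈ L, F.Valid φ

/-! ## Bisimulations -/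

def IsBisim {W₁ W₂ : Type} (σ : Set ℕ) (M₁ : KModel W₁) (M₂ : KModel W₂)
    (β : W₁ → W₂ → Prop) : Prop :=
  ∀ x₁ x₂, β x₁ x₂ →
    (∀ p ∈ σ, x₁ ∈ M₁.v p ↔ x₂ ∈ M₂.v p) ∧
    (∀ y₁, M₁.F.R x₁ y₁ → ∃ y₂, M₂.F.R x₂ y₂ ∧ β y₁ y₂) ∧
    (∀ y₂, M₂.F.R x₂ y₂ → ∃ y₁, M₁.F.R x₁ y₁ ∧ β y₁ y₂)

def Bisimilar {W₁ W₂ : Type} (σ : Set ℕ) (M₁ : KModel W₁) (x₁ : W₁)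
    (M₂ : KModel W₂) (x₂ : W₂) : Prop :=
  ∃ β, IsBisim σ M₁ M₂ β ∧ β x₁ x₂

/-- the two points satisfy the same variables of `σ` -/
def SigAgree {W₁ W₂ : Type} (σ : Set ℕ) (M₁ : KModel W₁) (x₁ : W₁)
    (M₂ : KModel W₂) (x₂ : W₂) : Prop :=
  ∀ p ∈ σ, x₁ ∈ M₁.v p ↔ x₂ ∈ M₂.v p

/-- the two points have the same σ-type -/
def TypeEquiv {W₁ W₂ : Type} (σ : Set ℕ) (M₁ : KModel W₁) (x₁ : W₁)
    (M₂ : KModel W₂) (x₂ : W₂) : Prop :=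
  ∀ φ : MF, φ.sig ⊆ σ → (M₁.sat x₁ φ ↔ M₂.sat x₂ φ)

/-! ## Interpolants -/

def IsInterpolant (L : Set MF) (φ₁ φ₂ ι : MF) : Prop :=
  ι.sig ⊆ φ₁.sig ∩ φ₂.sig ∧ MF.imp φ₁ ι ∈ L ∧ MF.imp ι φ₂ ∈ L

def NoInterpolant (L : Set MF) (φ₁ φ₂ : MF) : Prop := ¬ ∃ ι, IsInterpolant L φ₁ φ₂ ι

def HasCIP (L : Set MF) : Prop :=
  ∀ φ₁ φ₂ : MF, MF.imp φ₁ φ₂ ∈ L → ∃ ι, IsInterpolant L φ₁ φ₂ ι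

/-- `k(φ₁,φ₂) = 3 + 3·max(|φ₁|,|φ₂|)` -/
def kBound (φ₁ φ₂ : MF) : ℕ := 3 + 3 * max φ₁.size φ₂.size

/-- the conjunction of a finite list of formulas -/
def conjList : List MF → MF
  | [] => .top
  | φ :: l => .and φ (conjList l)

/-! ## d-persistence and cofinal subframe logics -/

def DPersistent (L : Set MF) : Prop :=
  ∀ (W : Type) (F : KFrame W), F.IsGeneral → F.Descriptive → F.IsFrameFor L →
    KFrame.IsFrameFor ⟨F.R, (Set.univ : Set (Set W))⟩ L

def CofinalSet {W : Type} (F : KFrame W) (S : Set W) : Prop :=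
  ∀ x ∈ S, ∀ y, F.R x y → y ∈ S ∨ ∃ z ∈ S, F.R y z

/-- the subframe of `F` with underlying set `S` and internal sets `Q` -/
def subframeOn {W : Type} (F : KFrame W) (S : Set W) (Q : Set (Set W)) : KFrame S :=
  ⟨fun a b => F.R a.1 b.1, {T | ∃ X ∈ Q, T = (Subtype.val ⁻¹' X : Set S)}⟩

/-- the class of general frames of `L` is closed under cofinal subframes -/
def CofinalSubframeLogic (L : Set MF) : Prop :=
  ∀ (W : Type) (F : KFrame W) (S : Set W) (Q : Set (Set W)),
    F.IsGeneral → F.IsFrameFor L → Q ⊆ F.P → (∀ X ∈ Q, X ⊆ S) →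
    (subframeOn F S Q).IsGeneral → CofinalSet F S →
    (subframeOn F S Q).IsFrameFor L

/-- the subframe of `F` generated by a point `x` -/
def KFrame.genSub {W : Type} (F : KFrame W) (x : W) :
    KFrame {y : W // x = y ∨ F.R x y} :=
  ⟨fun a b => F.R a.1 b.1, {S | ∃ X ∈ F.P, S = Subtype.val ⁻¹' X}⟩

namespace KFrame

variable {W : Type}

theorem IsGeneral.trans_of_validates_K43 {F : KFrame W} (hg : F.IsGeneral) (hd : F.Descriptive)
    (hK : F.IsFrameFor K43) {x y z : W} (hxy : F.R x y) (hyz : F.R y z) : F.R x z := by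
  have hv : F.Valid ax4 := hK _ fun L _ hL => hL (by simp)
  rw [hd.2.1]
  intro X hX hzX
  by_contra hx
  have h := hv (fun _ => Xᶜ) (fun _ => hg.2.2.2.2.1 X hX) x
  simp only [ax4, MF.imp, MF.or, MF.box, KModel.sat, KFrame.dia, Set.mem_ofPred_eq,
    Set.mem_compl_iff] at h hx
  grind

theorem IsGeneral.connected_of_validates_K43 {F : KFrame W} (hg : F.IsGeneral)
    (hd : F.Descriptive) (hK : F.IsFrameFor K43) {x y z : W} (hxy : F.R x y) (hxz : F.R x z) :
    y = z ∨ F.R y z ∨ F.R z y := by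
  have hv : F.Valid ax43 := hK _ fun L _ hL => hL (by simp)
  obtain ⟨-, -, -, hinter, hcompl, -⟩ := hg
  by_contra! hne
  obtain ⟨hne, hyz, hzy⟩ := hne
  have hsep : ∃ S ∈ F.P, y ∈ S ∧ z ∉ S := by
    by_contra! hS
    refine hne (hd.1 y z fun X hX => ⟨hS X hX, fun hzX => ?_⟩)
    by_contra hyX
    exact hS _ (hcompl X hX) hyX hzX
  obtain ⟨S, hS, hyS, hzS⟩ := hsep
  rw [hd.2.1] at hyz hzy
  push Not at hyz hzy
  obtain ⟨X, hX, hzX, hyX⟩ := hyz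
  obtain ⟨Y, hY, hyY, hzY⟩ := hzy
  have h := hv (fun i => if i = 0 then (X ∩ Sᶜ)ᶜ else (Y ∩ S)ᶜ) (fun i => by
    split_ifs
    · exact hcompl _ (hinter _ hX _ (hcompl _ hS))
    · exact hcompl _ (hinter _ hY _ hS)) x
  simp only [ax43, MF.imp, MF.or, MF.box, MF.boxPlus, KModel.sat, KFrame.dia, Set.mem_ofPred_eq,
    Set.mem_compl_iff, Set.mem_inter_iff, if_true, one_ne_zero, if_false] at h hyX hzY
  clear hinter hcompl hv
  rcases not_and_or.1 h with h | h
  · exact h fun hn => hn ⟨y, hxy, by grind⟩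
  · exact h fun hn => hn ⟨z, hxz, by grind⟩

theorem Rooted.connected {F : KFrame W} {r : W} (hr : F.Rooted r) (hg : F.IsGeneral)
    (hd : F.Descriptive) (hK : F.IsFrameFor K43) (y z : W) : y = z ∨ F.R y z ∨ F.R z y := by
  rcases hr y with rfl | hy
  · exact (hr z).imp_right Or.inl
  rcases hr z with rfl | hz
  · exact Or.inr (Or.inr hy)
  exact hg.connected_of_validates_K43 hd hK hy hz

theorem mem_iff_of_mem_cluster {F : KFrame W} {G : Set (Set W)}
    (htr : ∀ {x y z}, F.R x y → F.R y z → F.R x z) {x y z : W} (hy : y ∈ F.cluster x)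
    (hz : z ∈ F.cluster x) (hyz : ∀ X ∈ G, y ∈ X ↔ z ∈ X) {X : Set W} (hX : genBy F.R G X) :
    y ∈ X ↔ z ∈ X := by
  induction hX with
  | basic h => exact hyz _ h
  | empty => rfl
  | univ => rfl
  | inter _ _ h₁ h₂ => simp [h₁, h₂]
  | compl _ h => simp [h]
  | dia _ _ =>
    simp only [Set.mem_ofPred_eq]
    rcases hy with rfl | ⟨hy, hy'⟩ <;> rcases hz with rfl | ⟨hz, hz'⟩
    · rfl
    · exact exists_congr fun w => and_congr_right fun _ => ⟨htr hz', htr hz⟩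
    · exact exists_congr fun w => and_congr_right fun _ => ⟨htr hy, htr hy'⟩
    · exact exists_congr fun w => and_congr_right fun _ =>
        ⟨fun h => htr hz' (htr hy h), fun h => htr hy' (htr hz h)⟩

theorem Descriptive.cluster_finite_ncard_le {F : KFrame W} (hd : F.Descriptive)
    (htr : ∀ {x y z}, F.R x y → F.R y z → F.R x z) {G : Set (Set W)} (hG : G.Finite)
    (hgen : F.GeneratedBy G) (x : W) :
    (F.cluster x).Finite ∧ (F.cluster x).ncard ≤ 2 ^ G.ncard := by
  have hmaps : ∀ y ∈ F.cluster x, {X ∈ G | y ∈ X} ∈ 𝒫 G := fun y _ => Set.sep_subset _ _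
  have hinj : Set.InjOn (fun y => {X ∈ G | y ∈ X}) (F.cluster x) := by
    intro y hy z hz hyz
    refine hd.1 y z fun X hX => mem_iff_of_mem_cluster htr hy hz (fun Y hY => ?_) (hgen ▸ hX)
    simpa [hY] using Set.ext_iff.1 hyz Y
  rw [← Set.ncard_powerset G hG]
  exact ⟨Set.Finite.of_injOn hmaps hinj hG.powerset,
    Set.ncard_le_ncard_of_injOn _ hmaps hinj hG.powerset⟩

/-- The points strictly above `f N` that lie below some member of the sequence `f`. -/
def chainTail (F : KFrame W) (f : ℕ → W) (N : ℕ) : Set W := {z | F.R (f N) z ∧ ∃ k, F.R z (f k)}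

/-- The points in the least cluster above every member of the sequence `f`. -/
def chainLimit (F : KFrame W) (f : ℕ → W) : Set W :=
  {c | (∀ i, F.R (f i) c) ∧ ∀ d, (∀ i, F.R (f i) d) → F.R c d}

theorem exists_chainLimit_of_frequently {F : KFrame W} (hg : F.IsGeneral) (hd : F.Descriptive)
    (htr : ∀ {x y z}, F.R x y → F.R y z → F.R x z) {G : Set (Set W)} (hGP : G ⊆ F.P)
    {f : ℕ → W} (hf : ∀ i, F.R (f i) (f (i + 1))) {T : Set (Set W)}
    (hT : ∃ᶠ N in Filter.atTop, ∃ z ∈ F.chainTail f N, {X ∈ G | z ∈ X} = T) :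
    ∃ c ∈ F.chainLimit f, {X ∈ G | c ∈ X} = T := by
  let 𝒳 : Set (Set W) := {X ∈ F.P | ∀ᶠ N in Filter.atTop,
    ∀ z ∈ F.chainTail f N, {X ∈ G | z ∈ X} = T → z ∈ X}
  obtain ⟨c, hc⟩ : (⋂₀ 𝒳).Nonempty := by
    refine hd.2.2 𝒳 (Set.sep_subset _ _) fun 𝒴 h𝒴 hfin => ?_
    obtain ⟨N, ⟨z, hz, hzT⟩, hN⟩ :=
      (hT.and_eventually ((Filter.eventually_all_finite hfin).2 fun X hX => (h𝒴 hX).2)).exists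
    exact ⟨z, fun X hX => hN X hX z hz hzT⟩
  obtain ⟨-, -, -, -, hcompl, hdia⟩ := hg
  refine ⟨c, ⟨fun i => ?_, fun d hfd => ?_⟩, ?_⟩
  · have hmono : ∀ N, i ≤ N → ∀ z, F.R (f N) z → F.R (f i) z := by
      intro N hN
      induction N, hN using Nat.le_induction with
      | base => exact fun z hz => hz
      | succ N _ ih => exact fun z hz => ih z (htr (hf N) hz)
    rw [hd.2.1]
    intro X hX hcX
    by_contra hi
    refine hc _ ⟨hcompl X hX, ?_⟩ hcX
    filter_upwards [Filter.eventually_ge_atTop i] with N hN z hz _ hzX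
    exact hi ⟨z, hzX, hmono N hN z hz.1⟩
  · rw [hd.2.1]
    refine fun X hX hdX => hc _ ⟨hdia X hX, Filter.Eventually.of_forall fun N z hz _ => ?_⟩
    obtain ⟨-, k, hk⟩ := hz
    exact ⟨d, hdX, htr hk (hfd k)⟩
  · ext X
    refine ⟨fun ⟨hXG, hcX⟩ => ?_, fun hXT => ?_⟩
    · by_contra hXT
      refine hc _ ⟨hcompl X (hGP hXG), Filter.Eventually.of_forall fun N z _ hz hzX => ?_⟩ hcX
      exact hXT (hz ▸ ⟨hXG, hzX⟩)
    · obtain ⟨N, z, -, hz⟩ := hT.exists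
      have hXG : X ∈ G := (hz ▸ hXT : X ∈ {X ∈ G | z ∈ X}).1
      refine ⟨hXG, hc X ⟨hGP hXG, Filter.Eventually.of_forall fun N w _ hw => ?_⟩⟩
      exact (hw ▸ hXT : X ∈ {X ∈ G | w ∈ X}).2

theorem mem_iff_of_mem_chainLimit {F : KFrame W} {G : Set (Set W)}
    (htr : ∀ {x y z}, F.R x y → F.R y z → F.R x z)
    (hcon : ∀ y z, y = z ∨ F.R y z ∨ F.R z y) {f : ℕ → W}
    (hf : ∀ i, F.R (f i) (f (i + 1))) {N : ℕ}
    (hN : ∀ z ∈ F.chainTail f N, ∃ c ∈ F.chainLimit f, ∀ X ∈ G, z ∈ X ↔ c ∈ X)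
    {X : Set W} (hX : genBy F.R G X) :
    ∀ z ∈ F.chainTail f N, ∀ c ∈ F.chainLimit f, (∀ X ∈ G, z ∈ X ↔ c ∈ X) → (z ∈ X ↔ c ∈ X) := by
  induction hX with
  | basic h => exact fun z _ c _ hzc => hzc _ h
  | empty => simp
  | univ => simp
  | inter _ _ h₁ h₂ => exact fun z hz c hc hzc => and_congr (h₁ z hz c hc hzc) (h₂ z hz c hc hzc)
  | compl _ h => exact fun z hz c hc hzc => not_congr (h z hz c hc hzc)
  | dia _ ih =>
    rintro z ⟨hNz, k, hzk⟩ c hc -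
    refine ⟨fun ⟨w, hwX, hzw⟩ => ?_, fun ⟨w, hwX, hcw⟩ => ⟨w, hwX, htr hzk (htr (hc.1 k) hcw)⟩⟩
    by_cases hw : ∀ i, F.R (f i) w
    · exact ⟨w, hwX, hc.2 w hw⟩
    · push Not at hw
      obtain ⟨i, hi⟩ := hw
      have hwi : F.R w (f (i + 1)) := by
        rcases hcon w (f i) with rfl | h | h
        · exact hf i
        · exact htr h (hf i)
        · exact absurd h hi
      have hwN : w ∈ F.chainTail f N := ⟨htr hNz hzw, i + 1, hwi⟩
      obtain ⟨e, he, hwe⟩ := hN w hwN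
      exact ⟨e, (ih w hwN e he hwe).1 hwX, hc.2 e he.1⟩

theorem Descriptive.not_exists_ascending_chain {F : KFrame W} (hg : F.IsGeneral)
    (hd : F.Descriptive) (htr : ∀ {x y z}, F.R x y → F.R y z → F.R x z)
    (hcon : ∀ y z, y = z ∨ F.R y z ∨ F.R z y) {G : Set (Set W)} (hG : G.Finite)
    (hgen : F.GeneratedBy G) : ¬ ∃ f : ℕ → W, ∀ i : ℕ, F.clLT (f i) (f (i + 1)) := by
  rintro ⟨f, hf⟩
  have hGP : G ⊆ F.P := fun X hX => hgen ▸ genBy.basic hX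
  obtain ⟨N, hN⟩ : ∃ N, ∀ z ∈ F.chainTail f N, ∃ c ∈ F.chainLimit f,
      ∀ X ∈ G, z ∈ X ↔ c ∈ X := by
    have hev : ∀ T ∈ 𝒫 G, ∀ᶠ N in Filter.atTop, ∀ z ∈ F.chainTail f N, {X ∈ G | z ∈ X} = T →
        ∃ c ∈ F.chainLimit f, {X ∈ G | c ∈ X} = T := by
      intro T _
      by_cases hT : ∃ᶠ N in Filter.atTop, ∃ z ∈ F.chainTail f N, {X ∈ G | z ∈ X} = T
      · exact Filter.Eventually.of_forall fun _ _ _ _ =>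
          exists_chainLimit_of_frequently hg hd htr hGP (fun i => (hf i).1) hT
      · rw [Filter.not_frequently] at hT
        exact hT.mono fun N hN z hz hzT => absurd ⟨z, hz, hzT⟩ hN
    obtain ⟨N, hN⟩ := ((Filter.eventually_all_finite hG.powerset).2 hev).exists
    refine ⟨N, fun z hz => ?_⟩
    obtain ⟨c, hc, hcz⟩ := hN _ (Set.sep_subset _ _) z hz rfl
    exact ⟨c, hc, fun X hX => by simpa [hX] using (Set.ext_iff.1 hcz X).symm⟩
  have hz : f (N + 1) ∈ F.chainTail f N := ⟨(hf N).1, N + 2, (hf (N + 1)).1⟩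
  obtain ⟨c, hc, hzc⟩ := hN _ hz
  have heq : f (N + 1) = c := hd.1 _ _ fun X hX =>
    mem_iff_of_mem_chainLimit htr hcon (fun i => (hf i).1) hN
      ((Set.ext_iff.1 hgen X).1 hX) _ hz c hc hzc
  exact (hf (N + 1)).2 (heq ▸ hc.1 (N + 2))

end KFrame

/-- In a rooted `n`-generated descriptive frame for `K4.3`, (a) there is no
infinite ascending chain of clusters, and (b) every cluster has at most `2^n` points. -/
theorem ngenerated_cluster_structure (W : Type) (F : KFrame W) (n : ℕ)
    (hg : F.IsGeneral) (hroot : ∃ r, F.Rooted r) (hn : F.NGenerated n)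
    (hd : F.Descriptive) (hK : F.IsFrameFor K43) :
    (¬ ∃ f : ℕ → W, ∀ i : ℕ, F.clLT (f i) (f (i + 1))) ∧
    (∀ x : W, (F.cluster x).Finite ∧ (F.cluster x).ncard ≤ 2 ^ n) := by
  obtain ⟨r, hr⟩ := hroot
  obtain ⟨G, hG, rfl, hgen⟩ := hn
  have htr : ∀ {x y z}, F.R x y → F.R y z → F.R x z := hg.trans_of_validates_K43 hd hK
  exact ⟨hd.not_exists_ascending_chain hg htr (hr.connected hg hd hK) hG hgen,
    hd.cluster_finite_ncard_le htr hG hgen⟩
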